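/- arXiv:2309.13422 — 3 statements merged into one kernel-verified Lean document; each statement's English description precedes it below -/
import Mathlib

section
/- Let 0<β<1, let f be integrable on (0,∞) and let g be measurable on (0,∞) with ∫₀^∞ |g(v)| K₀(βv) dv < ∞. Then for every x>0 the generalized Parseval-type equality holds: (f⋆g)(x) = √(2/π)·∫₀^∞ (F_s f)(y)·K[g](y)·sin(y)·cos(xy) dy. -/
open MeasureTheory Real Set

/-- The kernel function φ(x,u,v). -/
noncomputable def phiKer (x u v : ℝ) : ℝ :=
  Real.exp (-v * Real.cosh (x + u - 1)) + Real.exp (-v * Real.cosh (x - u + 1))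
    - Real.exp (-v * Real.cosh (x + u + 1)) - Real.exp (-v * Real.cosh (x - u - 1))

/-- The modified Bessel function of the second kind of order zero. -/
noncomputable def K0 (v : ℝ) : ℝ := ∫ t in Set.Ioi (0 : ℝ), Real.exp (-v * Real.cosh t)

/-- The trigonometric-weighted generalized convolution (f ⋆ g). -/
noncomputable def gconv (f g : ℝ → ℝ) (x : ℝ) : ℝ :=
  (1 / 4) * ∫ v in Set.Ioi (0 : ℝ), ∫ u in Set.Ioi (0 : ℝ), phiKer x u v * f u * g v

/-- Fourier cosine transform. -/
noncomputable def Fc (f : ℝ → ℝ) (y : ℝ) : ℝ :=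
  Real.sqrt (2 / Real.pi) * ∫ x in Set.Ioi (0 : ℝ), f x * Real.cos (x * y)

/-- Fourier sine transform. -/
noncomputable def Fs (f : ℝ → ℝ) (y : ℝ) : ℝ :=
  Real.sqrt (2 / Real.pi) * ∫ x in Set.Ioi (0 : ℝ), f x * Real.sin (x * y)

/-- Modified Bessel function K_{iy}(x). -/
noncomputable def Kiy (y x : ℝ) : ℝ :=
  ∫ u in Set.Ioi (0 : ℝ), Real.exp (-x * Real.cosh u) * Real.cos (y * u)

/-- Kontorovich–Lebedev transform. -/
noncomputable def KL (g : ℝ → ℝ) (y : ℝ) : ℝ := ∫ x in Set.Ioi (0 : ℝ), Kiy y x * g x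

/-- Fourier cosine convolution. -/
noncomputable def fcConv (f g : ℝ → ℝ) (x : ℝ) : ℝ :=
  (1 / Real.sqrt (2 * Real.pi)) * ∫ u in Set.Ioi (0 : ℝ), f u * (g |x - u| + g (x + u))

/-- Fourier sine–cosine generalized convolution. -/
noncomputable def fscConv (f g : ℝ → ℝ) (x : ℝ) : ℝ :=
  (1 / Real.sqrt (2 * Real.pi)) * ∫ u in Set.Ioi (0 : ℝ), f u * (g |x - u| - g (x + u))


open scoped FourierTransform

/-- The Fourier integral of an even real function reduces to a cosine integral on the half-line. -/
lemma integral_cexp_mul_of_even {F : ℝ → ℝ} (hF : Integrable F) (heven : ∀ u, F (-u) = F u)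
    (c : ℝ) :
    ∫ u, Complex.exp (↑(c * u) * Complex.I) * (F u : ℂ)
      = ((2 * ∫ u in Ioi (0 : ℝ), F u * cos (c * u) : ℝ) : ℂ) := by
  have hcos : Integrable (fun u => F u * cos (c * u)) := by
    refine hF.mul_bdd (c := 1) (by fun_prop) (ae_of_all _ fun u => ?_)
    simpa using abs_cos_le_one (c * u)
  have hsin : Integrable (fun u => F u * sin (c * u)) := by
    refine hF.mul_bdd (c := 1) (by fun_prop) (ae_of_all _ fun u => ?_)
    simpa using abs_sin_le_one (c * u)
  have hsin0 : ∫ u, F u * sin (c * u) = 0 := by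
    have h := integral_neg_eq_self (fun u => F u * sin (c * u)) volume
    simp only [heven, mul_neg, sin_neg, integral_neg] at h
    linarith
  have hfold : ∫ u, F u * cos (c * u) = 2 * ∫ u in Ioi (0 : ℝ), F u * cos (c * u) := by
    rw [← integral_comp_abs]
    refine integral_congr_ae (ae_of_all _ fun u => ?_)
    rcases abs_choice u with h | h <;> simp [h, heven]
  have hsplit : ∀ u, Complex.exp (↑(c * u) * Complex.I) * (F u : ℂ)
      = ((F u * cos (c * u) : ℝ) : ℂ) + ((F u * sin (c * u) : ℝ) : ℂ) * Complex.I := by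
    intro u
    rw [Complex.exp_mul_I]
    push_cast
    ring
  simp_rw [hsplit]
  rw [integral_add hcos.ofReal (hsin.ofReal.mul_const _), integral_mul_const,
    integral_complex_ofReal, integral_complex_ofReal, hsin0, hfold]
  simp

/-- Fourier cosine inversion for a continuous integrable even function whose cosine transform
is integrable. -/
lemma cosine_inversion {h H : ℝ → ℝ} (hc : Continuous h) (hi : Integrable h)
    (heven : ∀ u, h (-u) = h u) (hH : ∀ y, H y = ∫ u in Ioi (0 : ℝ), h u * cos (y * u))
    (hHi : Integrable H) (t : ℝ) :
    ∫ y in Ioi (0 : ℝ), H y * cos (y * t) = π / 2 * h t := by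
  have hHeven : ∀ y, H (-y) = H y := fun y => by simp [hH]
  have hFT : 𝓕 (fun u => (h u : ℂ)) = fun w => ((2 * H (2 * π * w) : ℝ) : ℂ) := by
    ext w
    rw [Real.fourier_real_eq_integral_exp_smul]
    have := integral_cexp_mul_of_even hi heven (-(2 * π * w))
    simp only [smul_eq_mul]
    rw [← hHeven, hH, ← this]
    refine integral_congr_ae (ae_of_all _ fun u => ?_)
    simp only
    congr 4
    ring
  have hHi' : Integrable (fun w => 2 * H (2 * π * w)) :=
    (hHi.comp_mul_left' (by positivity)).const_mul 2
  have hic : Integrable (fun u => (h u : ℂ)) := hi.ofReal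
  have hinv := hic.fourierInv_fourier_eq (v := t)
    (by rw [hFT]; exact hHi'.ofReal) (by fun_prop)
  rw [hFT, Real.fourierInv_eq'] at hinv
  have h2 := integral_cexp_mul_of_even hHi' (fun w => by simp [hHeven]) (2 * π * t)
  have h3 : ((2 * ∫ w in Ioi (0 : ℝ), 2 * H (2 * π * w) * cos (2 * π * t * w) : ℝ) : ℂ)
      = (h t : ℂ) := by
    rw [← h2, ← hinv]
    refine integral_congr_ae (ae_of_all _ fun u => ?_)
    simp only [smul_eq_mul, RCLike.inner_apply, conj_trivial]
    congr 4
    ring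
  have h4 := integral_comp_mul_left_Ioi (fun y => H y * cos (y * t)) 0
    (b := 2 * π) (by positivity)
  have h5 : ∫ w in Ioi (0 : ℝ), 2 * H (2 * π * w) * cos (2 * π * t * w)
      = 2 * ∫ w in Ioi (0 : ℝ), H (2 * π * w) * cos (2 * π * w * t) := by
    rw [← integral_const_mul]
    refine integral_congr_ae (ae_of_all _ fun u => ?_)
    simp only
    rw [mul_right_comm (2 * π) t u]
    ring
  have h6 := Complex.ofReal_injective h3
  simp only [mul_zero, smul_eq_mul] at h4
  rw [h5, h4] at h6
  rw [← h6]
  generalize ∫ y in Ioi (0 : ℝ), H y * cos (y * t) = I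
  field_simp

lemma sq_div_four_le_cosh (u : ℝ) : u ^ 2 / 4 ≤ cosh u := by
  have h := quadratic_le_exp_of_nonneg (abs_nonneg u)
  have h' := exp_pos (-|u|)
  rw [← cosh_abs, cosh_eq]
  rw [sq_abs] at h
  linarith [abs_nonneg u]

lemma integrable_exp_neg_mul_cosh {v : ℝ} (hv : 0 < v) :
    Integrable (fun u => exp (-v * cosh u)) := by
  refine (integrable_exp_neg_mul_sq (b := v / 4) (by positivity)).mono' (by fun_prop)
    (ae_of_all _ fun u => ?_)
  rw [norm_of_nonneg (exp_pos _).le, exp_le_exp]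
  nlinarith [mul_le_mul_of_nonneg_left (sq_div_four_le_cosh u) hv.le]

lemma one_add_add_sq_mul_exp_neg_le {a s : ℝ} (ha : 0 < a) (ha' : a ≤ 1) (hs : 0 ≤ s) :
    (1 + s + s ^ 2) * exp (-s) ≤ 2 / a ^ 2 * exp (-((1 - a) * s)) := by
  have h := quadratic_le_exp_of_nonneg (mul_nonneg ha.le hs)
  have h1 : 1 + s + s ^ 2 ≤ 2 / a ^ 2 * exp (a * s) := by
    rw [div_mul_eq_mul_div, le_div_iff₀ (by positivity)]
    nlinarith [mul_nonneg hs (mul_nonneg ha.le (sub_nonneg.2 ha')),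
      mul_nonneg ha.le (sub_nonneg.2 ha')]
  calc (1 + s + s ^ 2) * exp (-s) ≤ (2 / a ^ 2 * exp (a * s)) * exp (-s) := by gcongr
    _ = _ := by rw [mul_assoc, ← exp_add]; ring_nf

lemma tendsto_cosh_atTop : Filter.Tendsto cosh Filter.atTop Filter.atTop := by
  refine Filter.tendsto_atTop_mono sq_div_four_le_cosh ?_
  exact (Filter.tendsto_pow_atTop two_ne_zero).atTop_div_const (by norm_num)

lemma abs_sinh_le_cosh (u : ℝ) : |sinh u| ≤ cosh u :=
  abs_le_of_sq_le_sq (by linarith [cosh_sq u]) (cosh_pos u).le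

lemma abs_Kiy_weight_le {v : ℝ} (hv : 0 < v) (u : ℝ) :
    |(1 + v * cosh u - v ^ 2 * sinh u ^ 2) * exp (-v * cosh u)|
      ≤ (1 + v * cosh u + (v * cosh u) ^ 2) * exp (-(v * cosh u)) := by
  have hc := cosh_pos u
  rw [abs_mul, abs_of_pos (exp_pos _), neg_mul]
  gcongr
  have h1 : 0 < v * cosh u := by positivity
  have h2 : v ^ 2 * sinh u ^ 2 ≤ (v * cosh u) ^ 2 := by
    rw [mul_pow]
    exact mul_le_mul_of_nonneg_left (by linarith [cosh_sq u]) (sq_nonneg v)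
  have h3 : 0 ≤ v ^ 2 * sinh u ^ 2 := by positivity
  rw [abs_le]
  constructor <;> nlinarith

lemma abs_Kiy_weight_le_exp {β v : ℝ} (hβ : β ∈ Ioo (0 : ℝ) 1) (hv : 0 < v) (u : ℝ) :
    |(1 + v * cosh u - v ^ 2 * sinh u ^ 2) * exp (-v * cosh u)|
      ≤ 2 / (1 - β) ^ 2 * exp (-(β * v) * cosh u) := by
  have hc := cosh_pos u
  refine (abs_Kiy_weight_le hv u).trans
    ((one_add_add_sq_mul_exp_neg_le (sub_pos.2 hβ.2) (by linarith [hβ.1])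
      (by positivity)).trans_eq ?_)
  ring_nf

/-- Two integrations by parts in the integral defining `Kiy`. -/
lemma one_add_sq_mul_Kiy {v : ℝ} (hv : 0 < v) (y : ℝ) :
    (1 + y ^ 2) * Kiy y v = ∫ u in Ioi (0 : ℝ),
      (1 + v * cosh u - v ^ 2 * sinh u ^ 2) * exp (-v * cosh u) * cos (y * u) := by
  have hw : Integrable (fun u => (1 + v * cosh u - v ^ 2 * sinh u ^ 2) * exp (-v * cosh u)) := by
    refine ((integrable_exp_neg_mul_cosh (v := 1 / 2 * v) (by positivity)).const_mul
      (2 / (1 - 1 / 2) ^ 2)).mono' (by fun_prop) (ae_of_all _ fun u => ?_)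
    exact abs_Kiy_weight_le_exp (by norm_num) hv u
  have hcosb : ∀ᵐ u ∂(volume : Measure ℝ), ‖cos (y * u)‖ ≤ 1 :=
    ae_of_all _ fun u => abs_cos_le_one (y * u)
  have hwc := (hw.mul_bdd (by fun_prop) hcosb).integrableOn (s := Ioi 0)
  have hhc := (((integrable_exp_neg_mul_cosh hv).mul_bdd (by fun_prop) hcosb).const_mul
    (1 + y ^ 2)).integrableOn (s := Ioi 0)
  have hderiv : ∀ u ∈ Ici (0 : ℝ), HasDerivAt
      (fun u => (-v * sinh u * cos (y * u) + y * sin (y * u)) * exp (-v * cosh u))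
      ((1 + y ^ 2) * (exp (-v * cosh u) * cos (y * u))
        - (1 + v * cosh u - v ^ 2 * sinh u ^ 2) * exp (-v * cosh u) * cos (y * u)) u := by
    intro u _
    have hyu : HasDerivAt (fun u => y * u) y u := by simpa using (hasDerivAt_id u).const_mul y
    have h1 := (((((hasDerivAt_sinh u).const_mul (-v)).mul hyu.cos).add
      (hyu.sin.const_mul y)).mul ((hasDerivAt_cosh u).const_mul (-v)).exp)
    refine h1.congr_deriv ?_
    simp only [Pi.add_apply, Pi.mul_apply]
    ring
  have hlim : Filter.Tendsto
      (fun u => (-v * sinh u * cos (y * u) + y * sin (y * u)) * exp (-v * cosh u))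
      Filter.atTop (nhds 0) := by
    have hs : Filter.Tendsto (fun s : ℝ => s * exp (-s) + |y| * exp (-s))
        Filter.atTop (nhds 0) := by
      have h1 := tendsto_pow_mul_exp_neg_atTop_nhds_zero 1
      have h2 := tendsto_pow_mul_exp_neg_atTop_nhds_zero 0
      simpa using h1.add (h2.const_mul |y|)
    refine squeeze_zero_norm (fun u => ?_)
      (hs.comp (tendsto_cosh_atTop.const_mul_atTop hv))
    simp only [Function.comp_apply, norm_mul, norm_eq_abs, abs_exp, ← add_mul, neg_mul]
    gcongr
    refine (abs_add_le _ _).trans (add_le_add ?_ ?_)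
    · rw [abs_neg, abs_mul, abs_mul, abs_of_pos hv, mul_assoc]
      gcongr
      exact (mul_le_of_le_one_right (abs_nonneg _) (abs_cos_le_one _)).trans (abs_sinh_le_cosh u)
    · rw [abs_mul]
      exact mul_le_of_le_one_right (abs_nonneg _) (abs_sin_le_one _)
  have hFTC := integral_Ioi_of_hasDerivAt_of_tendsto' hderiv (hhc.sub hwc) hlim
  rw [integral_sub hhc hwc, integral_const_mul] at hFTC
  simp only [sinh_zero, mul_zero, sin_zero, zero_mul, add_zero, sub_zero, sub_eq_zero] at hFTC
  exact hFTC

/-- Decay of `Kiy` in its index, uniformly relative to `K0 (β * v)`. -/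
lemma abs_Kiy_le {β v : ℝ} (hβ : β ∈ Ioo (0 : ℝ) 1) (hv : 0 < v) (y : ℝ) :
    |Kiy y v| ≤ 2 / (1 - β) ^ 2 * K0 (β * v) * (1 + y ^ 2)⁻¹ := by
  have hpos : 0 < 1 + y ^ 2 := by positivity
  rw [← div_eq_mul_inv, le_div_iff₀ hpos, ← abs_of_pos hpos, ← abs_mul, mul_comm (Kiy y v),
    one_add_sq_mul_Kiy hv, K0, ← integral_const_mul, ← norm_eq_abs]
  refine norm_integral_le_of_norm_le
    ((integrable_exp_neg_mul_cosh (mul_pos hβ.1 hv)).const_mul _).integrableOn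
    (ae_of_all _ fun u => ?_)
  rw [norm_mul]
  exact (mul_le_of_le_one_right (norm_nonneg _) (abs_cos_le_one _)).trans
    (abs_Kiy_weight_le_exp hβ hv u)

lemma measurable_Kiy : Measurable (fun p : ℝ × ℝ => Kiy p.1 p.2) := by
  refine (StronglyMeasurable.integral_prod_right (f := fun (p : ℝ × ℝ) (u : ℝ) =>
    exp (-p.2 * cosh u) * cos (p.1 * u)) ?_).measurable
  exact Continuous.stronglyMeasurable (by fun_prop)

lemma integrable_Kiy {v : ℝ} (hv : 0 < v) : Integrable (fun y => Kiy y v) := by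
  refine (integrable_inv_one_add_sq.const_mul
    (2 / (1 - 1 / 2) ^ 2 * K0 (1 / 2 * v))).mono'
    (measurable_Kiy.comp (measurable_id.prodMk measurable_const)).aestronglyMeasurable
    (ae_of_all _ fun y => ?_)
  exact abs_Kiy_le (by norm_num) hv y

lemma integral_Kiy_mul_cos {v : ℝ} (hv : 0 < v) (t : ℝ) :
    ∫ y in Ioi (0 : ℝ), Kiy y v * cos (y * t) = π / 2 * exp (-v * cosh t) :=
  cosine_inversion (by fun_prop) (integrable_exp_neg_mul_cosh hv) (by simp) (fun _ => rfl)
    (integrable_Kiy hv) t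

lemma integral_Kiy_mul_sin_mul_sin_mul_cos {v : ℝ} (hv : 0 < v) (x u : ℝ) :
    ∫ y in Ioi (0 : ℝ), Kiy y v * (sin (u * y) * sin y * cos (x * y))
      = π / 8 * phiKer x u v := by
  have hi : ∀ t, IntegrableOn (fun y => Kiy y v * cos (y * t)) (Ioi 0) := fun t =>
    ((integrable_Kiy hv).mul_bdd (c := 1) (by fun_prop)
      (ae_of_all _ fun y => abs_cos_le_one (y * t))).integrableOn
  have hsplit : ∀ y, Kiy y v * (sin (u * y) * sin y * cos (x * y))
      = 1 / 4 * (Kiy y v * cos (y * (x + u - 1)) + Kiy y v * cos (y * (x - u + 1))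
        - Kiy y v * cos (y * (x + u + 1)) - Kiy y v * cos (y * (x - u - 1))) := by
    intro y
    have e1 : y * (x + u - 1) = x * y + (u * y - y) := by ring
    have e2 : y * (x - u + 1) = x * y - (u * y - y) := by ring
    have e3 : y * (x + u + 1) = x * y + (u * y + y) := by ring
    have e4 : y * (x - u - 1) = x * y - (u * y + y) := by ring
    rw [e1, e2, e3, e4, cos_add (x * y), cos_add (x * y), cos_sub (x * y), cos_sub (x * y),
      cos_add (u * y), cos_sub (u * y)]
    ring
  have h2 : IntegrableOn (fun y => Kiy y v * cos (y * (x + u - 1))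
      + Kiy y v * cos (y * (x - u + 1))) (Ioi 0) := (hi _).add (hi _)
  have h3 : IntegrableOn (fun y => Kiy y v * cos (y * (x + u - 1))
      + Kiy y v * cos (y * (x - u + 1)) - Kiy y v * cos (y * (x + u + 1))) (Ioi 0) :=
    h2.sub (hi _)
  simp_rw [hsplit]
  rw [integral_const_mul, integral_sub h3 (hi _), integral_sub h2 (hi _),
    integral_add (hi _) (hi _)]
  simp_rw [integral_Kiy_mul_cos hv, phiKer]
  ring

/-- Absolute integrability justifying Fubini in the Parseval-type identity. -/
lemma integrable_parseval_integrand {β : ℝ} (hβ : β ∈ Ioo (0 : ℝ) 1) {f g : ℝ → ℝ}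
    (hf : IntegrableOn f (Ioi 0)) (hg : Measurable g)
    (hgK : IntegrableOn (fun v => |g v| * K0 (β * v)) (Ioi 0)) (x : ℝ) :
    Integrable (fun p : ℝ × ℝ × ℝ => Kiy p.1 p.2.1 * (sin (p.2.2 * p.1) * sin p.1 * cos (x * p.1))
        * (g p.2.1 * f p.2.2))
      ((volume.restrict (Ioi 0)).prod
        ((volume.restrict (Ioi 0)).prod (volume.restrict (Ioi 0)))) := by
  have hdom := ((integrable_inv_one_add_sq.integrableOn (s := Ioi 0)).mul_prod
    (hgK.mul_prod hf.norm)).const_mul (2 / (1 - β) ^ 2)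
  refine hdom.mono' ?_ ?_
  · have hK : Measurable (fun p : ℝ × ℝ × ℝ => Kiy p.1 p.2.1) :=
      measurable_Kiy.comp (measurable_fst.prodMk (measurable_fst.comp measurable_snd))
    have hgm : Measurable (fun p : ℝ × ℝ × ℝ => g p.2.1) :=
      hg.comp (measurable_fst.comp measurable_snd)
    have hfm : AEStronglyMeasurable (fun p : ℝ × ℝ × ℝ => f p.2.2)
        ((volume.restrict (Ioi 0)).prod
          ((volume.restrict (Ioi 0)).prod (volume.restrict (Ioi 0)))) :=
      hf.aestronglyMeasurable.comp_snd.comp_snd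
    refine (hK.aestronglyMeasurable.mul ?_).mul (hgm.aestronglyMeasurable.mul hfm)
    exact Continuous.aestronglyMeasurable (by fun_prop)
  · have hpos : ∀ᵐ p : ℝ × ℝ × ℝ ∂((volume.restrict (Ioi 0)).prod
          ((volume.restrict (Ioi 0)).prod (volume.restrict (Ioi 0)))), 0 < p.2.1 := by
      have h1 : ∀ᵐ v ∂(volume.restrict (Ioi (0 : ℝ))), 0 < v :=
        ae_restrict_mem measurableSet_Ioi
      exact Measure.quasiMeasurePreserving_snd.ae (Measure.quasiMeasurePreserving_fst.ae h1)
    filter_upwards [hpos] with p hp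
    have hK := abs_Kiy_le hβ hp p.1
    have htrig : |sin (p.2.2 * p.1) * sin p.1 * cos (x * p.1)| ≤ 1 := by
      rw [abs_mul, abs_mul]
      exact mul_le_one₀ (mul_le_one₀ (abs_sin_le_one _) (abs_nonneg _) (abs_sin_le_one _))
        (abs_nonneg _) (abs_cos_le_one _)
    simp only [norm_mul _ (g p.2.1 * f p.2.2), norm_mul (Kiy _ _), norm_mul (g _), norm_eq_abs]
    calc _ ≤ |Kiy p.1 p.2.1| * 1 * (|g p.2.1| * |f p.2.2|) := by gcongr
      _ ≤ 2 / (1 - β) ^ 2 * K0 (β * p.2.1) * (1 + p.1 ^ 2)⁻¹ * 1 * (|g p.2.1| * |f p.2.2|) := by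
          gcongr
      _ = _ := by ring

theorem gconv_parseval (β : ℝ) (hβ : β ∈ Set.Ioo (0 : ℝ) 1) (f g : ℝ → ℝ)
    (hf : MeasureTheory.IntegrableOn f (Set.Ioi 0))
    (hg : Measurable g)
    (hgK : MeasureTheory.IntegrableOn (fun v => |g v| * K0 (β * v)) (Set.Ioi 0))
    (x : ℝ) (hx : 0 < x) :
    gconv f g x = Real.sqrt (2 / Real.pi) *
      ∫ y in Set.Ioi (0 : ℝ), Fs f y * KL g y * Real.sin y * Real.cos (x * y) := by

  set μ : Measure ℝ := volume.restrict (Ioi 0) with hμ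
  have hint := integrable_parseval_integrand hβ hf hg hgK x
  have hpos : ∀ᵐ v ∂μ, 0 < v := ae_restrict_mem measurableSet_Ioi
  have hinner : ∀ᵐ z ∂(μ.prod μ),
      ∫ y in Ioi (0 : ℝ), Kiy y z.1 * (sin (z.2 * y) * sin y * cos (x * y)) * (g z.1 * f z.2)
        = π / 8 * (phiKer x z.2 z.1 * f z.2 * g z.1) := by
    filter_upwards [Measure.quasiMeasurePreserving_fst.ae hpos] with z hz
    rw [integral_mul_const, integral_Kiy_mul_sin_mul_sin_mul_cos hz]
    ring
  have hphi : Integrable (fun z : ℝ × ℝ => π / 8 * (phiKer x z.2 z.1 * f z.2 * g z.1))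
      (μ.prod μ) := hint.integral_prod_right.congr hinner
  have hrhs : ∀ y, Fs f y * KL g y * sin y * cos (x * y)
      = √(2 / π) * ∫ z, Kiy y z.1 * (sin (z.2 * y) * sin y * cos (x * y)) * (g z.1 * f z.2)
          ∂(μ.prod μ) := by
    intro y
    have h := integral_prod_mul (μ := μ) (ν := μ) (fun v => Kiy y v * g v)
      (fun u => f u * sin (u * y))
    have h' : ∫ z, Kiy y z.1 * (sin (z.2 * y) * sin y * cos (x * y)) * (g z.1 * f z.2) ∂(μ.prod μ)
        = (sin y * cos (x * y)) *
          ∫ z : ℝ × ℝ, Kiy y z.1 * g z.1 * (f z.2 * sin (z.2 * y)) ∂(μ.prod μ) := by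
      rw [← integral_const_mul]
      congr 1 with z
      ring
    rw [h', h, Fs, KL]
    ring
  have hswap := integral_integral_swap (μ := μ) (ν := μ.prod μ)
    (f := fun y z => Kiy y z.1 * (sin (z.2 * y) * sin y * cos (x * y)) * (g z.1 * f z.2)) hint
  have hsqrt : √(2 / π) * √(2 / π) = 2 / π := mul_self_sqrt (by positivity)
  simp_rw [hrhs]
  rw [integral_const_mul, hswap, integral_congr_ae hinner, integral_prod _ hphi, gconv,
    ← mul_assoc, hsqrt]
  simp_rw [integral_const_mul]
  rw [← mul_assoc, hμ]
  congr 1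
  field_simp
  norm_num
end

section
/- Let p∈(1,∞), let ρ₁,ρ₂ be nonnegative measurable functions on (0,∞), and let F₁,F₂ be measurable functions with ∫₀^∞ |F₁(u)|^p ρ₁(u) du < ∞ and ∫₀^∞ K₀(v)|F₂(v)|^p ρ₂(v) dv < ∞. Define A(x) = (1/4)∫₀^∞∫₀^∞ |φ(x,u,v)| |F₁(u)|ρ₁(u) |F₂(v)|ρ₂(v) du dv and B(x) = (1/4)∫₀^∞∫₀^∞ |φ(x,u,v)| ρ₁(u)ρ₂(v) du dv, and assume 0 < B(x) < ∞ for almost every x>0. Then the Saitoh-type inequality holds: ∫₀^∞ A(x)^p · B(x)^{1−p} dx ≤ 2·(∫₀^∞ |F₁(u)|^p ρ₁(u) du)·(∫₀^∞ K₀(v)|F₂(v)|^p ρ₂(v) dv). -/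
open MeasureTheory Real Set

/-- The Hölder inequality for `f` against the weight `w`, raised to the power `p`. -/
theorem lintegral_weighted_rpow_le {α : Type*} [MeasurableSpace α] {μ : Measure α} {p : ℝ}
    (hp : 1 < p) {w f : α → ENNReal} (hw : AEMeasurable w μ) (hf : AEMeasurable f μ) :
    (∫⁻ a, w a * f a ∂μ) ^ p ≤ (∫⁻ a, w a * f a ^ p ∂μ) * (∫⁻ a, w a ∂μ) ^ (p - 1) := by
  have hp0 : 0 < p := by linarith
  have h1 : p⁻¹ + (1 - p⁻¹) = 1 := by ring
  have hq : 0 ≤ 1 - p⁻¹ := sub_nonneg.2 (inv_le_one_of_one_le₀ hp.le)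
  have h := ENNReal.lintegral_mul_norm_pow_le (hw.mul (hf.pow_const p)) hw
    (inv_nonneg.2 hp0.le) hq h1
  have e : ∀ a, (w a * f a ^ p) ^ p⁻¹ * w a ^ (1 - p⁻¹) = w a * f a := fun a => by
    rw [ENNReal.mul_rpow_of_nonneg _ _ (inv_nonneg.2 hp0.le), ENNReal.rpow_rpow_inv hp0.ne',
      mul_right_comm, ← ENNReal.rpow_add_of_nonneg _ _ (inv_nonneg.2 hp0.le) hq, h1,
      ENNReal.rpow_one]
  simp only [Pi.mul_apply, e] at h
  refine (ENNReal.rpow_le_rpow h hp0.le).trans_eq ?_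
  rw [ENNReal.mul_rpow_of_nonneg _ _ hp0.le, ENNReal.rpow_inv_rpow hp0.ne', ← ENNReal.rpow_mul]
  congr 2
  field_simp

theorem integrableOn_exp_neg_mul_cosh {v : ℝ} (hv : 0 < v) :
    IntegrableOn (fun t => Real.exp (-v * Real.cosh t)) (Set.Ioi 0) := by
  refine (exp_neg_integrableOn_Ioi 0 hv).mono' (by fun_prop) ?_
  filter_upwards [ae_restrict_mem measurableSet_Ioi] with t ht
  rw [Real.norm_eq_abs, Real.abs_exp, Real.exp_le_exp]
  have : t ≤ Real.cosh t := (Real.self_le_sinh_iff.2 (le_of_lt ht)).trans (Real.sinh_lt_cosh t).le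
  nlinarith

theorem K0_nonneg (v : ℝ) : 0 ≤ K0 v := integral_nonneg fun _ => (Real.exp_pos _).le

theorem lintegral_exp_neg_mul_cosh {v : ℝ} (hv : 0 < v) :
    ∫⁻ t, ENNReal.ofReal (Real.exp (-v * Real.cosh t)) = 2 * ENNReal.ofReal (K0 v) := by
  have hpos : ∫⁻ t in Set.Ioi (0 : ℝ), ENNReal.ofReal (Real.exp (-v * Real.cosh t))
      = ENNReal.ofReal (K0 v) :=
    (ofReal_integral_eq_lintegral_ofReal (integrableOn_exp_neg_mul_cosh hv)
      (Filter.Eventually.of_forall fun _ => (Real.exp_pos _).le)).symm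
  have hneg : ∫⁻ t in Set.Iic (0 : ℝ), ENNReal.ofReal (Real.exp (-v * Real.cosh t))
      = ENNReal.ofReal (K0 v) := by
    rw [← hpos, setLIntegral_congr Iio_ae_eq_Iic.symm, ← lintegral_indicator measurableSet_Iio,
      ← lintegral_indicator measurableSet_Ioi, ← lintegral_neg_eq_self]
    refine lintegral_congr fun t => ?_
    simp [Set.indicator]
  rw [← lintegral_add_compl _ (measurableSet_Ioi (a := (0 : ℝ))), Set.compl_Ioi, hpos, hneg,
    two_mul]

theorem enorm_phiKer_le (x u v : ℝ) :
    ‖phiKer x u v‖ₑ ≤ ENNReal.ofReal (Real.exp (-v * Real.cosh (x + (u - 1))))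
      + ENNReal.ofReal (Real.exp (-v * Real.cosh (x + (1 - u))))
      + ENNReal.ofReal (Real.exp (-v * Real.cosh (x + (u + 1))))
      + ENNReal.ofReal (Real.exp (-v * Real.cosh (x + (-u - 1)))) := by
  have e (y : ℝ) : ENNReal.ofReal (Real.exp y) = ‖Real.exp y‖ₑ :=
    (Real.enorm_of_nonneg (Real.exp_pos y).le).symm
  simp only [e]
  have h1 : x + u - 1 = x + (u - 1) := by ring
  have h2 : x - u + 1 = x + (1 - u) := by ring
  have h3 : x + u + 1 = x + (u + 1) := by ring
  have h4 : x - u - 1 = x + (-u - 1) := by ring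
  rw [phiKer, h1, h2, h3, h4]
  refine enorm_sub_le.trans (add_le_add ?_ le_rfl)
  exact enorm_sub_le.trans (add_le_add (enorm_add_le _ _) le_rfl)

theorem lintegral_enorm_phiKer_le (u : ℝ) {v : ℝ} (hv : 0 < v) :
    ∫⁻ x in Set.Ioi (0 : ℝ), ‖phiKer x u v‖ₑ ≤ 8 * ENNReal.ofReal (K0 v) := by
  have hm : Measurable fun t => ENNReal.ofReal (Real.exp (-v * Real.cosh t)) := by fun_prop
  have hshift (a : ℝ) : ∫⁻ x, ENNReal.ofReal (Real.exp (-v * Real.cosh (x + a)))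
      = 2 * ENNReal.ofReal (K0 v) := by
    rw [lintegral_add_right_eq_self (fun t => ENNReal.ofReal (Real.exp (-v * Real.cosh t))) a,
      lintegral_exp_neg_mul_cosh hv]
  refine (setLIntegral_le_lintegral _ _).trans
    ((lintegral_mono fun x => enorm_phiKer_le x u v).trans_eq ?_)
  rw [lintegral_add_right _ (by fun_prop), lintegral_add_right _ (by fun_prop),
    lintegral_add_right _ (by fun_prop)]
  simp only [hshift]
  ring

@[fun_prop]
theorem Measurable.phiKer {α : Type*} [MeasurableSpace α] {x u v : α → ℝ} (hx : Measurable x)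
    (hu : Measurable u) (hv : Measurable v) : Measurable fun a => phiKer (x a) (u a) (v a) := by
  unfold _root_.phiKer
  fun_prop

theorem saitoh_type_inequality (p : ℝ) (hp : 1 < p) (ρ₁ ρ₂ F₁ F₂ : ℝ → ℝ)
    (hρ₁m : Measurable ρ₁) (hρ₂m : Measurable ρ₂)
    (hρ₁ : ∀ x ∈ Set.Ioi (0 : ℝ), 0 ≤ ρ₁ x) (hρ₂ : ∀ x ∈ Set.Ioi (0 : ℝ), 0 ≤ ρ₂ x)
    (hF₁m : Measurable F₁) (hF₂m : Measurable F₂)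
    (hF₁ : MeasureTheory.IntegrableOn (fun u => |F₁ u| ^ p * ρ₁ u) (Set.Ioi 0))
    (hF₂ : MeasureTheory.IntegrableOn (fun v => K0 v * (|F₂ v| ^ p * ρ₂ v)) (Set.Ioi 0))
    (A B : ℝ → ℝ)
    (hA : A = fun x => (1 / 4) * ∫ v in Set.Ioi (0 : ℝ), ∫ u in Set.Ioi (0 : ℝ),
      |phiKer x u v| * (|F₁ u| * ρ₁ u) * (|F₂ v| * ρ₂ v))
    (hB : B = fun x => (1 / 4) * ∫ v in Set.Ioi (0 : ℝ), ∫ u in Set.Ioi (0 : ℝ),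
      |phiKer x u v| * ρ₁ u * ρ₂ v)
    (hBfin : ∀ᵐ x ∂(MeasureTheory.volume.restrict (Set.Ioi (0 : ℝ))), 0 < B x ∧
      MeasureTheory.IntegrableOn (fun w : ℝ × ℝ => |phiKer x w.1 w.2| * ρ₁ w.1 * ρ₂ w.2)
        (Set.Ioi 0 ×ˢ Set.Ioi 0)) :
    (∫ x in Set.Ioi (0 : ℝ), A x ^ p * B x ^ (1 - p)) ≤
      2 * (∫ u in Set.Ioi (0 : ℝ), |F₁ u| ^ p * ρ₁ u) *
        (∫ v in Set.Ioi (0 : ℝ), K0 v * (|F₂ v| ^ p * ρ₂ v)) := by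
  set μ : Measure ℝ := volume.restrict (Set.Ioi (0 : ℝ)) with hμ
  have hp0 : 0 < p := by linarith
  have hπ : (volume : Measure (ℝ × ℝ)).restrict (Set.Ioi 0 ×ˢ Set.Ioi 0) = μ.prod μ := by
    rw [hμ, Measure.prod_restrict, Measure.volume_eq_prod]
  let w : ℝ → ℝ × ℝ → ENNReal := fun x z =>
    ‖(1 / 4 : ℝ)‖ₑ * ‖|phiKer x z.1 z.2| * ρ₁ z.1 * ρ₂ z.2‖ₑ
  let f : ℝ × ℝ → ENNReal := fun z => ‖F₁ z.1‖ₑ * ‖F₂ z.2‖ₑ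
  have hw (x : ℝ) : Measurable (w x) := by fun_prop
  have hf : Measurable f := by fun_prop
  have hAle (x : ℝ) : ‖A x‖ₑ ≤ ∫⁻ z, w x z * f z ∂μ.prod μ := by
    have hwf (z : ℝ × ℝ) : w x z * f z = ‖(1 / 4 : ℝ)‖ₑ *
        ‖|phiKer x z.1 z.2| * (|F₁ z.1| * ρ₁ z.1) * (|F₂ z.2| * ρ₂ z.2)‖ₑ := by
      simp only [w, f, enorm_mul, Real.enorm_abs]
      ring
    simp only [hA, hwf, enorm_mul ((1 : ℝ) / 4)]
    rw [lintegral_const_mul _ (by fun_prop), lintegral_prod_symm _ (by fun_prop)]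
    gcongr
    refine (enorm_integral_le_lintegral_enorm _).trans (lintegral_mono fun v => ?_)
    exact enorm_integral_le_lintegral_enorm _
  have hBeq : ∀ᵐ x ∂μ, 0 < B x ∧ ‖B x‖ₑ = ∫⁻ z, w x z ∂μ.prod μ := by
    filter_upwards [hBfin] with x ⟨hx, hint⟩
    refine ⟨hx, ?_⟩
    rw [IntegrableOn, hπ] at hint
    have hnn : ∀ᵐ z ∂μ.prod μ, 0 ≤ |phiKer x z.1 z.2| * ρ₁ z.1 * ρ₂ z.2 := by
      rw [← hπ]
      filter_upwards [ae_restrict_mem (measurableSet_Ioi.prod measurableSet_Ioi)] with z hz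
      exact mul_nonneg (mul_nonneg (abs_nonneg _) (hρ₁ _ hz.1)) (hρ₂ _ hz.2)
    simp only [w, hB, enorm_mul ((1 : ℝ) / 4)]
    rw [lintegral_const_mul _ (by fun_prop), ← ofReal_integral_norm_eq_lintegral_enorm hint,
      ← integral_prod_symm _ hint, Real.enorm_of_nonneg (integral_nonneg_of_ae hnn)]
    congr 2
    refine integral_congr_ae ?_
    filter_upwards [hnn] with z hz
    exact (Real.norm_of_nonneg hz).symm
  have hpt : ∀ᵐ x ∂μ, ‖A x ^ p * B x ^ (1 - p)‖ₑ ≤ ∫⁻ z, w x z * f z ^ p ∂μ.prod μ := by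
    filter_upwards [hBeq] with x ⟨hx, hBx⟩
    have hB0 : ‖B x‖ₑ ≠ 0 := enorm_ne_zero.2 hx.ne'
    calc ‖A x ^ p * B x ^ (1 - p)‖ₑ ≤ ‖A x‖ₑ ^ p * ‖B x‖ₑ ^ (1 - p) := by
          rw [enorm_mul]
          gcongr
          · rw [← Real.enorm_abs (A x), ← Real.enorm_rpow_of_nonneg (abs_nonneg _) hp0.le]
            refine enorm_le_iff_norm_le.2 ?_
            simpa [abs_of_nonneg (Real.rpow_nonneg (abs_nonneg (A x)) p)]
              using Real.abs_rpow_le_abs_rpow (A x) p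
          · rw [Real.enorm_of_nonneg hx.le, ENNReal.ofReal_rpow_of_pos hx,
              Real.enorm_of_nonneg (Real.rpow_nonneg hx.le _)]
      _ ≤ (∫⁻ z, w x z * f z ∂μ.prod μ) ^ p * ‖B x‖ₑ ^ (1 - p) := by
          gcongr
          exact hAle x
      _ ≤ (∫⁻ z, w x z * f z ^ p ∂μ.prod μ) * ‖B x‖ₑ ^ (p - 1) * ‖B x‖ₑ ^ (1 - p) := by
          gcongr
          rw [hBx]
          exact lintegral_weighted_rpow_le hp (hw x).aemeasurable hf.aemeasurable
      _ = ∫⁻ z, w x z * f z ^ p ∂μ.prod μ := by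
          rw [mul_assoc, ← ENNReal.rpow_add _ _ hB0 enorm_ne_top]
          simp
  let G₁ : ℝ → ENNReal := fun u => ‖|F₁ u| ^ p * ρ₁ u‖ₑ
  let G₂ : ℝ → ENNReal := fun v => ‖K0 v * (|F₂ v| ^ p * ρ₂ v)‖ₑ
  have hkey : ∫⁻ x, ‖A x ^ p * B x ^ (1 - p)‖ₑ ∂μ ≤ 2 * ((∫⁻ u, G₁ u ∂μ) * ∫⁻ v, G₂ v ∂μ) := by
    have hpos : ∀ᵐ z ∂μ.prod μ, 0 < z.2 := by
      rw [← hπ]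
      filter_upwards [ae_restrict_mem (measurableSet_Ioi.prod measurableSet_Ioi)] with z hz
      exact hz.2
    have hG₂ : AEMeasurable G₂ μ := hF₂.aestronglyMeasurable.enorm
    rw [← lintegral_prod_mul hF₁.aestronglyMeasurable.enorm hG₂,
      ← lintegral_const_mul' _ _ (by simp)]
    refine (lintegral_mono_ae hpt).trans ?_
    rw [lintegral_lintegral_swap (by fun_prop)]
    refine lintegral_mono_ae ?_
    filter_upwards [hpos] with z hz
    have e (x : ℝ) : w x z * f z ^ p = ‖phiKer x z.1 z.2‖ₑ *
        (‖(1 / 4 : ℝ)‖ₑ * (‖ρ₁ z.1‖ₑ * ‖ρ₂ z.2‖ₑ) * f z ^ p) := by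
      simp only [w, enorm_mul, Real.enorm_abs]
      ring
    have h8 : (8 : ENNReal) * ‖(1 / 4 : ℝ)‖ₑ = 2 := by
      rw [Real.enorm_of_nonneg (by norm_num), ← ENNReal.ofReal_ofNat 8,
        ← ENNReal.ofReal_mul (by norm_num)]
      norm_num
    have hrp (y : ℝ) : ‖|y| ^ p‖ₑ = ‖y‖ₑ ^ p := by
      rw [Real.enorm_rpow_of_nonneg (abs_nonneg _) hp0.le, Real.enorm_abs]
    simp only [e]
    rw [lintegral_mul_const _ (by fun_prop)]
    calc _ ≤ 8 * ENNReal.ofReal (K0 z.2) *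
          (‖(1 / 4 : ℝ)‖ₑ * (‖ρ₁ z.1‖ₑ * ‖ρ₂ z.2‖ₑ) * f z ^ p) := by
          gcongr
          exact lintegral_enorm_phiKer_le z.1 hz
      _ = 8 * ‖(1 / 4 : ℝ)‖ₑ * (G₁ z.1 * G₂ z.2) := by
          simp only [f, G₁, G₂, enorm_mul, hrp, ENNReal.mul_rpow_of_nonneg _ _ hp0.le,
            Real.enorm_of_nonneg (K0_nonneg z.2)]
          ring
      _ = 2 * (G₁ z.1 * G₂ z.2) := by rw [h8]
  have lintegral_eq {g : ℝ → ℝ} (hg : Integrable g μ) (hg0 : ∀ x ∈ Set.Ioi (0 : ℝ), 0 ≤ g x) :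
      ∫⁻ x, ‖g x‖ₑ ∂μ = ENNReal.ofReal (∫ x, g x ∂μ) := by
    rw [← ofReal_integral_norm_eq_lintegral_enorm hg]
    congr 1
    exact setIntegral_congr_fun measurableSet_Ioi fun x hx => Real.norm_of_nonneg (hg0 x hx)
  have h₁ (u : ℝ) (hu : u ∈ Set.Ioi (0 : ℝ)) : 0 ≤ |F₁ u| ^ p * ρ₁ u :=
    mul_nonneg (Real.rpow_nonneg (abs_nonneg _) _) (hρ₁ u hu)
  have h₂ (v : ℝ) (hv : v ∈ Set.Ioi (0 : ℝ)) : 0 ≤ K0 v * (|F₂ v| ^ p * ρ₂ v) :=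
    mul_nonneg (K0_nonneg v) (mul_nonneg (Real.rpow_nonneg (abs_nonneg _) _) (hρ₂ v hv))
  have i₁ := setIntegral_nonneg (μ := volume) measurableSet_Ioi h₁
  have i₂ := setIntegral_nonneg (μ := volume) measurableSet_Ioi h₂
  simp only [G₁, G₂] at hkey
  rw [lintegral_eq hF₁ h₁, lintegral_eq hF₂ h₂, ← ENNReal.ofReal_mul i₁, ← ENNReal.ofReal_ofNat 2,
    ← ENNReal.ofReal_mul (by norm_num)] at hkey
  have hfin := (enorm_integral_le_lintegral_enorm _).trans hkey
  rw [Real.enorm_eq_ofReal_abs, ENNReal.ofReal_le_ofReal_iff (by positivity)] at hfin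
  rw [mul_assoc]
  exact (le_abs_self _).trans hfin
end

section
/- Let f,g be integrable on (0,∞) and suppose that the function y ↦ (1+y²)(F_c g)(y) is integrable on (0,∞). Then the Fourier cosine convolution f ∗_{F_c} g is twice differentiable on (0,∞) and for every x>0, (f ∗_{F_c} g)(x) − (d²/dx²)(f ∗_{F_c} g)(x) = √(2/π)·∫₀^∞ (1+y²)(F_c f)(y)(F_c g)(y) cos(xy) dy. If moreover the function x ↦ (f ∗_{F_c} g)(x) − (d²/dx²)(f ∗_{F_c} g)(x) is integrable on (0,∞), then for every y>0 its Fourier cosine transform equals (1+y²)(F_c f)(y)(F_c g)(y). -/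
open MeasureTheory Real Set

open scoped FourierTransform ContDiff

/-- Fourier inversion almost everywhere, with no continuity assumption on `f`. -/
theorem ae_fourierInv_fourier_eq {f : ℝ → ℂ} (hf : Integrable f) (hFf : Integrable (𝓕 f)) :
    ∀ᵐ x, 𝓕⁻ (𝓕 f) x = f x := by
  have hc : Continuous (𝓕⁻ (𝓕 f)) :=
    VectorFourier.fourierIntegral_continuous Real.continuous_fourierChar
      (L := -innerₗ ℝ) (by fun_prop) hFf
  refine ae_eq_of_integral_contDiff_smul_eq hc.locallyIntegrable hf.locallyIntegrable
    fun φ hφ hφc => ?_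
  let ψ : SchwartzMap ℝ ℂ := HasCompactSupport.toSchwartzMap
    (f := fun x => (φ x : ℂ)) (hφc.comp_left Complex.ofReal_zero)
    (Complex.ofRealCLM.contDiff.comp hφ)
  have hψ : ∀ x, ψ x = φ x := fun x => rfl
  let θ : SchwartzMap ℝ ℂ := 𝓕⁻ ψ
  have hθ : 𝓕 (θ : ℝ → ℂ) = ψ := by
    rw [← SchwartzMap.fourier_coe, FourierTransform.fourier_fourierInv_eq]
  have hθ' : 𝓕⁻ (ψ : ℝ → ℂ) = θ := (SchwartzMap.fourierInv_coe ψ).symm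
  have h1 : ∫ x, ψ x • f x = ∫ x, θ x • 𝓕 f x := by
    rw [← hθ]
    simpa using! VectorFourier.integral_fourierIntegral_smul_eq_flip (L := innerₗ ℝ)
      Real.continuous_fourierChar continuous_inner (θ.integrable (μ := volume)) hf
  have h2 : ∫ x, θ x • 𝓕 f x = ∫ x, ψ x • 𝓕⁻ (𝓕 f) x := by
    rw [← hθ']
    have hL : (-innerₗ ℝ).flip = -innerₗ ℝ := by ext; simp
    have := VectorFourier.integral_fourierIntegral_smul_eq_flip (L := -innerₗ ℝ)
      Real.continuous_fourierChar (by fun_prop) (ψ.integrable (μ := volume)) hFf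
    rwa [hL] at this
  simpa [hψ] using (h1.trans h2).symm

theorem integrableOn_mul_cos {k : ℝ → ℝ} {s : Set ℝ} (hk : IntegrableOn k s) (t : ℝ) :
    IntegrableOn (fun y => k y * Real.cos (y * t)) s :=
  Integrable.mul_bdd (c := 1) hk (by fun_prop)
    (.of_forall fun y => by simpa using Real.abs_cos_le_one _)

theorem integrableOn_mul_sin {k : ℝ → ℝ} {s : Set ℝ} (hk : IntegrableOn k s) (t : ℝ) :
    IntegrableOn (fun y => k y * Real.sin (y * t)) s :=
  Integrable.mul_bdd (c := 1) hk (by fun_prop)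
    (.of_forall fun y => by simpa using Real.abs_sin_le_one _)

theorem abs_Fc_le (k : ℝ → ℝ) (hk : IntegrableOn k (Ioi 0)) (y : ℝ) :
    |Fc k y| ≤ √(2 / π) * ∫ x in Ioi (0 : ℝ), |k x| := by
  rw [Fc, abs_mul, abs_of_nonneg (Real.sqrt_nonneg _)]
  gcongr
  refine (abs_integral_le_integral_abs).trans
    (integral_mono (integrableOn_mul_cos hk y).abs hk.abs fun x => ?_)
  simp only [abs_mul]
  exact mul_le_of_le_one_right (abs_nonneg _) (Real.abs_cos_le_one _)

theorem continuous_Fc {k : ℝ → ℝ} (hk : IntegrableOn k (Ioi 0)) : Continuous (Fc k) := by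
  refine continuous_const.mul (continuous_of_dominated (bound := fun x => |k x|)
    (fun y => (integrableOn_mul_cos hk y).aestronglyMeasurable)
    (fun y => .of_forall fun x => ?_) hk.abs (.of_forall fun x => by fun_prop))
  rw [Real.norm_eq_abs, abs_mul]
  exact mul_le_of_le_one_right (abs_nonneg _) (Real.abs_cos_le_one _)

theorem Fc_neg (k : ℝ → ℝ) (y : ℝ) : Fc k (-y) = Fc k y := by
  simp [Fc]

theorem Fc_abs (k : ℝ → ℝ) (y : ℝ) : Fc k |y| = Fc k y := by
  rcases abs_choice y with h | h <;> simp [h, Fc_neg]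

theorem Fc_const_mul (c : ℝ) (k : ℝ → ℝ) (y : ℝ) : Fc (fun x => c * k x) y = c * Fc k y := by
  simp only [Fc, mul_assoc, integral_const_mul]
  ring

theorem Fc_congr {k l : ℝ → ℝ} (h : EqOn k l (Ioi 0)) (y : ℝ) : Fc k y = Fc l y := by
  unfold Fc
  congr 1
  exact setIntegral_congr_fun measurableSet_Ioi fun x hx => by simp only [h hx]

theorem Fc_comp_mul_left (k : ℝ → ℝ) {c : ℝ} (hc : 0 < c) (y : ℝ) :
    Fc (fun x => k (c * x)) (c * y) = c⁻¹ * Fc k y := by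
  have h := integral_comp_mul_left_Ioi (fun x => k x * Real.cos (x * y)) 0 hc
  simp only [mul_zero, smul_eq_mul] at h
  unfold Fc
  rw [mul_left_comm, ← h]
  congr 2 with x
  ring_nf

theorem integral_eq_integral_Ioi_add_comp_neg {E : Type*} [NormedAddCommGroup E]
    [NormedSpace ℝ E] {F : ℝ → E} (hF : Integrable F) :
    ∫ x, F x = ∫ x in Ioi (0 : ℝ), (F x + F (-x)) := by
  rw [integral_add hF.integrableOn hF.comp_neg.integrableOn, integral_comp_neg_Ioi, neg_zero,
    add_comm, intervalIntegral.integral_Iic_add_Ioi hF.integrableOn hF.integrableOn]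

theorem integrable_comp_abs {E : Type*} [NormedAddCommGroup E] {k : ℝ → E}
    (hk : IntegrableOn k (Ioi 0)) : Integrable (fun x => k |x|) := by
  have h1 : IntegrableOn (fun x => k |x|) (Ioi 0) :=
    hk.congr_fun (fun x hx => by simp [abs_of_pos (mem_Ioi.1 hx)]) measurableSet_Ioi
  have h2 : IntegrableOn (fun x => k |x|) (Iic 0) := by
    rw [← integrableOn_Ici_iff_integrableOn_Ioi] at h1
    simpa using h1.comp_neg
  rw [← integrableOn_univ, ← Iic_union_Ioi (a := (0 : ℝ))]
  exact h2.union h1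

theorem fourier_comp_abs {k : ℝ → ℝ} (hk : IntegrableOn k (Ioi 0)) (ξ : ℝ) :
    𝓕 (fun x : ℝ => (k |x| : ℂ)) ξ = ((√(2 * π) * Fc k (2 * π * ξ) : ℝ) : ℂ) := by
  have hi : Integrable (fun x : ℝ => (k |x| : ℂ)) := (integrable_comp_abs hk).ofReal
  have hs : √(2 * π) * √(2 / π) = 2 := by
    rw [← Real.sqrt_mul (by positivity), show 2 * π * (2 / π) = 2 ^ 2 by field_simp]
    exact Real.sqrt_sq (by norm_num)
  rw [Real.fourier_real_eq, integral_eq_integral_Ioi_add_comp_neg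
    (by simpa [mul_comm] using! (Real.fourierIntegral_convergent_iff ξ).2 hi), Fc, ← mul_assoc, hs,
    ← integral_const_mul, ← integral_complex_ofReal]
  refine setIntegral_congr_fun measurableSet_Ioi fun x hx => ?_
  simp only [abs_neg, abs_of_pos (mem_Ioi.1 hx), Circle.smul_def, Real.fourierChar_apply,
    smul_eq_mul, Complex.ofReal_mul, Complex.ofReal_cos, Complex.cos]
  push_cast
  ring_nf

/-- Fourier cosine inversion, stated for the even extension of `k`. -/
theorem ae_Fc_Fc_eq {k : ℝ → ℝ} (hk : IntegrableOn k (Ioi 0)) (hFk : IntegrableOn (Fc k) (Ioi 0)) :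
    ∀ᵐ t : ℝ, Fc (Fc k) t = k |t| := by
  have hπ : 0 < 2 * π := by positivity
  have hl : IntegrableOn (fun ξ => √(2 * π) * Fc k (2 * π * ξ)) (Ioi 0) := by
    refine Integrable.const_mul ?_ _
    have := (integrableOn_Ioi_comp_mul_left_iff (Fc k) 0 hπ).2 (by simpa using hFk)
    exact this
  have hF : 𝓕 (fun x : ℝ => (k |x| : ℂ)) =
      fun ξ => (((fun ξ => √(2 * π) * Fc k (2 * π * ξ)) |ξ| : ℝ) : ℂ) := by
    ext ξ
    rw [fourier_comp_abs hk]
    simp only [← Fc_abs k (2 * π * ξ), abs_mul, abs_of_pos hπ]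
  have hi : Integrable (fun x : ℝ => (k |x| : ℂ)) := (integrable_comp_abs hk).ofReal
  have h := ae_fourierInv_fourier_eq hi
    (by rw [hF]; exact (integrable_comp_abs hl).ofReal)
  filter_upwards [h] with t ht
  rw [hF, Real.fourierInv_eq_fourier_neg, fourier_comp_abs hl, Fc_const_mul,
    Fc_comp_mul_left _ hπ, Fc_neg, ← mul_assoc, ← mul_assoc, Real.mul_self_sqrt hπ.le,
    mul_inv_cancel₀ hπ.ne', one_mul] at ht
  exact_mod_cast ht

/-- The Fourier cosine convolution is the cosine transform of the product of the transforms. -/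
theorem fcConv_eq_Fc_mul {f g : ℝ → ℝ} (hf : IntegrableOn f (Ioi 0)) (hg : IntegrableOn g (Ioi 0))
    (hFg : IntegrableOn (Fc g) (Ioi 0)) {x : ℝ} (hx : 0 < x) :
    fcConv f g x = Fc (fun y => Fc f y * Fc g y) x := by
  have hae := ae_Fc_Fc_eq hg hFg
  have hsub : ∀ᵐ u : ℝ, Fc (Fc g) (x - u) = g |x - u| :=
    (Measure.measurePreserving_sub_left volume x).quasiMeasurePreserving.ae hae
  have hadd : ∀ᵐ u : ℝ, Fc (Fc g) (x + u) = g |x + u| :=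
    (measurePreserving_add_left volume x).quasiMeasurePreserving.ae hae
  have hsum : ∀ u, Fc (Fc g) (x - u) + Fc (Fc g) (x + u) =
      √(2 / π) * ∫ y in Ioi (0 : ℝ), 2 * (Fc g y * Real.cos (y * x) * Real.cos (y * u)) := by
    intro u
    rw [Fc, Fc, ← mul_add, ← integral_add (integrableOn_mul_cos hFg _) (integrableOn_mul_cos hFg _)]
    congr 2 with y
    rw [mul_sub, mul_add, Real.cos_sub, Real.cos_add]
    ring
  have hprod : Integrable (Function.uncurry fun u y : ℝ =>
      f u * (Fc g y * Real.cos (y * x) * Real.cos (y * u)))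
      ((volume.restrict (Ioi 0)).prod (volume.restrict (Ioi 0))) := by
    have h := (Integrable.mul_prod hf (integrableOn_mul_cos hFg x)).mul_bdd (c := 1)
      (g := fun p : ℝ × ℝ => Real.cos (p.2 * p.1)) (by fun_prop)
      (.of_forall fun p => by simpa using Real.abs_cos_le_one _)
    refine h.congr (.of_forall fun p => ?_)
    simp only [Function.uncurry]
    ring
  have hs : 1 / √(2 * π) * 2 = √(2 / π) := by
    rw [Real.sqrt_div (by norm_num), Real.sqrt_mul (by norm_num)]
    have := Real.mul_self_sqrt (show (0 : ℝ) ≤ 2 by norm_num)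
    have : √π ≠ 0 := by positivity
    field_simp
    linarith
  calc fcConv f g x
      = 1 / √(2 * π) * ∫ u in Ioi (0 : ℝ), √(2 / π) * 2 *
          ∫ y in Ioi (0 : ℝ), f u * (Fc g y * Real.cos (y * x) * Real.cos (y * u)) := by
        rw [fcConv]
        congr 1
        refine setIntegral_congr_ae measurableSet_Ioi ?_
        filter_upwards [hsub, hadd] with u h1 h2 hu
        rw [← h1, ← abs_of_pos (add_pos hx (mem_Ioi.1 hu)), ← h2, hsum, integral_const_mul,
          integral_const_mul]
        ring
    _ = √(2 / π) * ∫ y in Ioi (0 : ℝ), √(2 / π) *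
          ∫ u in Ioi (0 : ℝ), f u * (Fc g y * Real.cos (y * x) * Real.cos (y * u)) := by
        rw [integral_const_mul, integral_const_mul, integral_integral_swap hprod, ← hs]
        ring
    _ = Fc (fun y => Fc f y * Fc g y) x := by
        conv_rhs => rw [Fc]
        congr 2 with y
        rw [show Fc f y = √(2 / π) * ∫ u in Ioi (0 : ℝ), f u * Real.cos (u * y) from rfl,
          mul_assoc, mul_assoc, ← integral_mul_const]
        congr 2 with u
        rw [mul_comm u y]
        ring

theorem hasDerivAt_integral_mul_cos {k : ℝ → ℝ} (hk : IntegrableOn k (Ioi 0))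
    (hyk : IntegrableOn (fun y => y * k y) (Ioi 0)) (x : ℝ) :
    HasDerivAt (fun x => ∫ y in Ioi (0 : ℝ), k y * Real.cos (y * x))
      (-∫ y in Ioi (0 : ℝ), y * k y * Real.sin (y * x)) x := by
  rw [← integral_neg]
  refine (hasDerivAt_integral_of_dominated_loc_of_deriv_le (bound := fun y => |y * k y|)
    (F' := fun x y => -(y * k y * Real.sin (y * x)))
    Filter.univ_mem (.of_forall fun x => (integrableOn_mul_cos hk x).aestronglyMeasurable)
    (integrableOn_mul_cos hk x) (integrableOn_mul_sin hyk x).neg.aestronglyMeasurable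
    (.of_forall fun y x _ => ?_) hyk.abs (.of_forall fun y x _ => ?_)).2
  · rw [norm_neg, Real.norm_eq_abs, abs_mul]
    exact mul_le_of_le_one_right (abs_nonneg _) (Real.abs_sin_le_one _)
  · convert! (((hasDerivAt_id x).const_mul y).cos.const_mul (k y)) using 1
    simp only [id, mul_one]
    ring

theorem hasDerivAt_integral_mul_sin {k : ℝ → ℝ} (hk : IntegrableOn k (Ioi 0))
    (hyk : IntegrableOn (fun y => y * k y) (Ioi 0)) (x : ℝ) :
    HasDerivAt (fun x => ∫ y in Ioi (0 : ℝ), k y * Real.sin (y * x))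
      (∫ y in Ioi (0 : ℝ), y * k y * Real.cos (y * x)) x := by
  refine (hasDerivAt_integral_of_dominated_loc_of_deriv_le (bound := fun y => |y * k y|)
    (F' := fun x y => y * k y * Real.cos (y * x))
    Filter.univ_mem (.of_forall fun x => (integrableOn_mul_sin hk x).aestronglyMeasurable)
    (integrableOn_mul_sin hk x) (integrableOn_mul_cos hyk x).aestronglyMeasurable
    (.of_forall fun y x _ => ?_) hyk.abs (.of_forall fun y x _ => ?_)).2
  · rw [Real.norm_eq_abs, abs_mul]
    exact mul_le_of_le_one_right (abs_nonneg _) (Real.abs_cos_le_one _)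
  · convert! (((hasDerivAt_id x).const_mul y).sin.const_mul (k y)) using 1
    simp only [id, mul_one]
    ring

theorem integrableOn_mul_of_one_add_sq_mul {k w : ℝ → ℝ} {s : Set ℝ}
    (hk : IntegrableOn (fun y => (1 + y ^ 2) * k y) s) (hkc : Continuous k) (hw : Continuous w)
    (hle : ∀ y, |w y| ≤ 1 + y ^ 2) : IntegrableOn (fun y => w y * k y) s := by
  refine Integrable.mono hk (by fun_prop) (.of_forall fun y => ?_)
  rw [norm_mul, norm_mul]
  gcongr
  exact (hle y).trans (le_abs_self _)

theorem fcConv_integro_differential (f g : ℝ → ℝ)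
    (hf : MeasureTheory.IntegrableOn f (Set.Ioi 0))
    (hg : MeasureTheory.IntegrableOn g (Set.Ioi 0))
    (hFcg : MeasureTheory.IntegrableOn (fun y => (1 + y ^ 2) * Fc g y) (Set.Ioi 0)) :
    (∀ x ∈ Set.Ioi (0 : ℝ), DifferentiableAt ℝ (fcConv f g) x ∧
      DifferentiableAt ℝ (deriv (fcConv f g)) x ∧
      fcConv f g x - deriv (deriv (fcConv f g)) x =
        Real.sqrt (2 / Real.pi) *
          ∫ y in Set.Ioi (0 : ℝ), (1 + y ^ 2) * Fc f y * Fc g y * Real.cos (x * y)) ∧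
    (MeasureTheory.IntegrableOn
        (fun x => fcConv f g x - deriv (deriv (fcConv f g)) x) (Set.Ioi 0) →
      ∀ y ∈ Set.Ioi (0 : ℝ),
        Fc (fun x => fcConv f g x - deriv (deriv (fcConv f g)) x) y =
          (1 + y ^ 2) * Fc f y * Fc g y) := by

  set H : ℝ → ℝ := fun y => Fc f y * Fc g y with hH
  have hFgi : IntegrableOn (Fc g) (Ioi 0) := by
    simpa using integrableOn_mul_of_one_add_sq_mul hFcg (continuous_Fc hg)
      (continuous_const (y := (1 : ℝ))) (fun y => by rw [abs_one]; nlinarith [sq_nonneg y])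
  have hHc : Continuous H := (continuous_Fc hf).mul (continuous_Fc hg)
  have hHi : IntegrableOn (fun y => (1 + y ^ 2) * H y) (Ioi 0) := by
    have := Integrable.bdd_mul (c := √(2 / π) * ∫ x in Ioi (0 : ℝ), |f x|) hFcg
      (continuous_Fc hf).aestronglyMeasurable (.of_forall fun y => abs_Fc_le f hf y)
    exact this.congr (.of_forall fun y => by simp only [hH]; ring)
  have hH0 : IntegrableOn H (Ioi 0) := by
    simpa using integrableOn_mul_of_one_add_sq_mul hHi hHc
      (continuous_const (y := (1 : ℝ))) (fun y => by rw [abs_one]; nlinarith [sq_nonneg y])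
  have hH1 : IntegrableOn (fun y => y * H y) (Ioi 0) :=
    integrableOn_mul_of_one_add_sq_mul hHi hHc continuous_id fun y => by
      simp only [abs_le]; constructor <;> nlinarith [sq_nonneg (y - 1), sq_nonneg (y + 1)]
  have hH2 : IntegrableOn (fun y => y * (y * H y)) (Ioi 0) := by
    refine (integrableOn_mul_of_one_add_sq_mul hHi hHc (continuous_pow 2) fun y => ?_).congr
      (.of_forall fun y => by ring)
    rw [abs_of_nonneg (sq_nonneg y)]
    linarith
  have hconv : EqOn (fcConv f g) (Fc H) (Ioi 0) := fun x hx => fcConv_eq_Fc_mul hf hg hFgi hx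
  have hd1 : ∀ x ∈ Ioi (0 : ℝ), HasDerivAt (fcConv f g)
      (√(2 / π) * -∫ y in Ioi (0 : ℝ), y * H y * Real.sin (y * x)) x := fun x hx =>
    ((hasDerivAt_integral_mul_cos hH0 hH1 x).const_mul _).congr_of_eventuallyEq
      (hconv.eventuallyEq_of_mem (Ioi_mem_nhds hx))
  have hd2 : ∀ x ∈ Ioi (0 : ℝ), HasDerivAt (deriv (fcConv f g))
      (√(2 / π) * -∫ y in Ioi (0 : ℝ), y * (y * H y) * Real.cos (y * x)) x := fun x hx =>
    ((hasDerivAt_integral_mul_sin hH1 hH2 x).neg.const_mul _).congr_of_eventuallyEq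
      (EqOn.eventuallyEq_of_mem (fun z hz => (hd1 z hz).deriv) (Ioi_mem_nhds hx))
  have hmain : EqOn (fun x => fcConv f g x - deriv (deriv (fcConv f g)) x)
      (Fc fun y => (1 + y ^ 2) * H y) (Ioi 0) := fun x hx => by
    simp only [(hd2 x hx).deriv, hconv hx, Fc]
    rw [← mul_sub, sub_neg_eq_add, ← integral_add (integrableOn_mul_cos hH0 x)
      (integrableOn_mul_cos hH2 x)]
    congr 2 with y
    ring
  refine ⟨fun x hx => ⟨(hd1 x hx).differentiableAt, (hd2 x hx).differentiableAt, ?_⟩,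
    fun hint y hy => ?_⟩
  · refine (hmain hx).trans ?_
    rw [Fc]
    congr 2 with y
    rw [mul_comm x y]
    simp only [hH]
    ring
  · have hKi : IntegrableOn (Fc fun y => (1 + y ^ 2) * H y) (Ioi 0) :=
      hint.congr_fun hmain measurableSet_Ioi
    have hae : Fc (Fc fun y => (1 + y ^ 2) * H y) =ᵐ[volume.restrict (Ioi 0)]
        fun y => (1 + y ^ 2) * H y := by
      filter_upwards [ae_restrict_of_ae (ae_Fc_Fc_eq hHi hKi),
        ae_restrict_mem measurableSet_Ioi] with t ht ht0
      rw [ht, abs_of_pos ht0]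
    rw [Fc_congr hmain, Measure.eqOn_open_of_ae_eq hae isOpen_Ioi
      (continuous_Fc hKi).continuousOn (by fun_prop) hy]
    simp only [hH]
    ring
end
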